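/- Nazarov's Gaussian anti-concentration inequality (Lemma E.2). Let G = (G_1, …, G_p) be a centered Gaussian random vector in R^p with p ≥ 2 such that E[G_j²] ≥ σ̲² for all j = 1, …, p and some constant σ̲ > 0. Then for every t = (t_1,…,t_p) ∈ R^p and every δ > 0: P(G_j ≤ t_j + δ for all j) − P(G_j ≤ t_j for all j) ≤ (δ/σ̲)(√(2 log p) + 2). -/

import Mathlib

open MeasureTheory ProbabilityTheory

lemma nz_pdf (x : ℝ) : gaussianPDFReal 0 1 x = (√(2 * Real.pi))⁻¹ * Real.exp (-x ^ 2 / 2) := by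
  simp [gaussianPDFReal]

lemma nz_pdf_deriv (x : ℝ) :
    HasDerivAt (gaussianPDFReal 0 1) (-x * gaussianPDFReal 0 1 x) x := by
  have h : gaussianPDFReal 0 1 = fun x : ℝ => (√(2 * Real.pi))⁻¹ * Real.exp (-x ^ 2 / 2) := by
    ext x; exact nz_pdf x
  rw [h]
  have h1 : HasDerivAt (fun x : ℝ => -x ^ 2 / 2) (-x) x := by
    have := ((hasDerivAt_pow 2 x).neg).div_const 2
    exact this.congr_deriv (by push_cast; ring)
  have := (h1.exp).const_mul ((√(2 * Real.pi))⁻¹)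
  exact this.congr_deriv (by ring)

lemma nz_const_le : (√(2 * Real.pi))⁻¹ ≤ 1 := by
  apply inv_le_one_of_one_le₀
  rw [Real.one_le_sqrt]
  linarith [Real.pi_gt_three]

lemma nz_pdf_tendsto : Filter.Tendsto (gaussianPDFReal 0 1) Filter.atTop (nhds 0) := by
  have h : gaussianPDFReal 0 1 = fun x : ℝ => (√(2 * Real.pi))⁻¹ * Real.exp (-x ^ 2 / 2) := by
    ext x; exact nz_pdf x
  rw [h, show (0:ℝ) = (√(2 * Real.pi))⁻¹ * 0 by simp]
  apply Filter.Tendsto.const_mul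
  apply Real.tendsto_exp_atBot.comp
  have : Filter.Tendsto (fun x : ℝ => x ^ 2 / 2) Filter.atTop Filter.atTop :=
    (Filter.tendsto_pow_atTop (by norm_num)).atTop_div_const (by norm_num)
  have h2 := Filter.tendsto_neg_atTop_atBot.comp this
  refine h2.congr fun x => ?_
  simp [neg_div]

lemma nz_mills (T x : ℝ) (hT : 0 ≤ T) (hx : x ≤ T) :
    gaussianPDFReal 0 1 x ≤ (T + 1) * (gaussianReal 0 1).real (Set.Ioi x) := by
  have hreal : (gaussianReal 0 1).real (Set.Ioi x) = ∫ u in Set.Ioi x, gaussianPDFReal 0 1 u := by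
    rw [measureReal_def, gaussianReal_apply_eq_integral 0 one_ne_zero,
      ENNReal.toReal_ofReal]
    exact integral_nonneg fun u => gaussianPDFReal_nonneg _ _ _
  rw [hreal]
  set I := ∫ u in Set.Ioi x, gaussianPDFReal 0 1 u with hI
  have key : ∀ b, x ≤ b → gaussianPDFReal 0 1 x / (T + 1) - gaussianPDFReal 0 1 b ≤ I := by
    intro b hb
    have hD : ∀ u, x ≤ u → 1 ≤ u - x + T + 1 := fun u hu => by linarith
    have h1 := intervalIntegral.sub_le_integral_of_hasDeriv_right_of_le (a := x) (b := b)
      (g := fun u => - (gaussianPDFReal 0 1 u / (u - x + T + 1)))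
      (g' := fun u => - ((-u * gaussianPDFReal 0 1 u * (u - x + T + 1)
        - gaussianPDFReal 0 1 u * 1) / (u - x + T + 1) ^ 2))
      (φ := gaussianPDFReal 0 1) hb ?_ ?_ ?_ ?_
    · have h2 : ∫ u in x..b, gaussianPDFReal 0 1 u ≤ I := by
        rw [intervalIntegral.integral_of_le hb, hI]
        apply setIntegral_mono_set
        · exact (integrable_gaussianPDFReal 0 1).integrableOn
        · exact Filter.Eventually.of_forall fun u => gaussianPDFReal_nonneg _ _ _
        · exact Filter.Eventually.of_forall fun u hu => hu.1
      have h3 : gaussianPDFReal 0 1 b / (b - x + T + 1) ≤ gaussianPDFReal 0 1 b :=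
        div_le_self (gaussianPDFReal_nonneg _ _ _) (hD b hb)
      simp only [sub_self, zero_add] at h1
      linarith
    · intro u hu
      have := hD u hu.1
      apply ContinuousAt.continuousWithinAt
      apply ContinuousAt.neg
      apply (nz_pdf_deriv u).continuousAt.div (by fun_prop)
      linarith
    · intro u hu
      have := hD u hu.1.le
      apply HasDerivAt.hasDerivWithinAt
      apply HasDerivAt.neg
      apply (nz_pdf_deriv u).fun_div
      · exact ((((hasDerivAt_id u).sub_const x).add_const T).add_const 1)
      · linarith
    · exact (integrable_gaussianPDFReal 0 1).integrableOn
    · intro u hu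
      have h4 := hD u hu.1.le
      have h5 := gaussianPDFReal_nonneg 0 1 u
      rw [← neg_div, div_le_iff₀ (by positivity)]
      have h6 : u ≤ (u - x + T + 1) - 1 := by linarith
      generalize u - x + T + 1 = D at *
      have : 0 ≤ D ^ 2 - u * D - 1 := by nlinarith
      nlinarith
  have h7 : gaussianPDFReal 0 1 x / (T + 1) - 0 ≤ I := by
    refine le_of_tendsto (nz_pdf_tendsto.const_sub _) ?_
    filter_upwards [Filter.eventually_ge_atTop x] with b hb using key b hb
  rw [sub_zero, div_le_iff₀ (by linarith)] at h7
  linarith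

lemma nz_far (p : ℕ) (hp : 2 ≤ p) (x : ℝ) (hx : √(2 * Real.log p) ≤ x) :
    gaussianPDFReal 0 1 x ≤ 1 / p := by
  have hp' : (0 : ℝ) < p := by positivity
  have hlog : 0 ≤ Real.log p := Real.log_natCast_nonneg p
  have h1 : 2 * Real.log p ≤ x ^ 2 := (Real.sqrt_le_left (le_trans (Real.sqrt_nonneg _) hx)).1 hx
  rw [nz_pdf]
  calc _ ≤ 1 * Real.exp (- Real.log p) := by
        apply mul_le_mul nz_const_le _ (Real.exp_nonneg _) zero_le_one
        apply Real.exp_le_exp.2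
        linarith
    _ = 1 / p := by rw [Real.exp_neg, Real.exp_log hp']; simp

lemma nz_pointwise (p : ℕ) (hp : 2 ≤ p) (x q : Fin p → ℝ) (hq0 : ∀ j, 0 ≤ q j)
    (hq1 : ∀ j, q j ≤ 1) (hsum : ∑ j, (gaussianReal 0 1).real (Set.Ioi (x j)) * q j ≤ 1) :
    ∑ j, gaussianPDFReal 0 1 (x j) * q j ≤ √(2 * Real.log p) + 2 := by
  have hT := Real.sqrt_nonneg (2 * Real.log p)
  set T := √(2 * Real.log p) with hTd
  have hp' : (0 : ℝ) < p := by positivity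
  calc ∑ j, gaussianPDFReal 0 1 (x j) * q j
      ≤ ∑ j, ((T + 1) * ((gaussianReal 0 1).real (Set.Ioi (x j)) * q j) + 1 / p) := by
        refine Finset.sum_le_sum fun j _ => ?_
        have hm : 0 ≤ (gaussianReal 0 1).real (Set.Ioi (x j)) := measureReal_nonneg
        rcases le_total (x j) T with h | h
        · have := mul_le_mul_of_nonneg_right (nz_mills T (x j) hT h) (hq0 j)
          have : 0 ≤ 1 / (p : ℝ) := by positivity
          linarith
        · have h1 := nz_far p hp (x j) h
          have h2 := gaussianPDFReal_nonneg 0 1 (x j)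
          have := mul_nonneg (by linarith : 0 ≤ T + 1) (mul_nonneg hm (hq0 j))
          nlinarith [hq0 j, hq1 j]
    _ = (T + 1) * (∑ j, (gaussianReal 0 1).real (Set.Ioi (x j)) * q j) + 1 := by
        rw [Finset.sum_add_distrib, ← Finset.mul_sum]
        simp
        field_simp
    _ ≤ T + 2 := by nlinarith

/-- Region for the residuals: all other shifted coordinates are below the `j`-th one,
strictly so for smaller indices. -/
def nzB {p : ℕ} (ρ : Fin p → Fin p → ℝ) (t : Fin p → ℝ) (j : Fin p) (x : ℝ) :
    Set (Fin p → ℝ) :=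
  {y | ∀ i, i ≠ j → y i + ρ i j * x ≤ t i + (x - t j) ∧
    (i < j → y i + ρ i j * x < t i + (x - t j))}

lemma nzB_meas {p : ℕ} (ρ : Fin p → Fin p → ℝ) (t : Fin p → ℝ) (j : Fin p) :
    MeasurableSet {z : ℝ × (Fin p → ℝ) | z.2 ∈ nzB ρ t j z.1} := by
  have : {z : ℝ × (Fin p → ℝ) | z.2 ∈ nzB ρ t j z.1} = ⋂ i, ⋂ (_ : i ≠ j),
      ({z : ℝ × (Fin p → ℝ) | z.2 i + ρ i j * z.1 ≤ t i + (z.1 - t j)} ∩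
        ⋂ (_ : i < j), {z : ℝ × (Fin p → ℝ) | z.2 i + ρ i j * z.1 < t i + (z.1 - t j)}) := by
    ext z
    simp [nzB]
  rw [this]
  refine MeasurableSet.iInter fun i => MeasurableSet.iInter fun _ => MeasurableSet.inter ?_ ?_
  · exact measurableSet_le (by fun_prop) (by fun_prop)
  · exact MeasurableSet.iInter fun _ => measurableSet_lt (by fun_prop) (by fun_prop)

lemma nzB_meas' {p : ℕ} (ρ : Fin p → Fin p → ℝ) (t : Fin p → ℝ) (j : Fin p) (x : ℝ) :
    MeasurableSet (nzB ρ t j x) :=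
  (nzB_meas ρ t j).preimage (measurable_prodMk_left (x := x))

lemma nz_tail_sum {p : ℕ} {Ω : Type*} [MeasurableSpace Ω]
    (P : Measure Ω) [IsProbabilityMeasure P] (X : Ω → Fin p → ℝ) (hX : Measurable X)
    (ρ : Fin p → Fin p → ℝ) (hsymm : ∀ i j, ρ i j = ρ j i) (hρ : ∀ i j, |ρ i j| ≤ 1)
    (hlaw : ∀ j, P.map (fun ω => X ω j) = gaussianReal 0 1)
    (hind : ∀ j, IndepFun (fun ω => X ω j) (fun ω i => X ω i - ρ i j * X ω j) P)
    (t : Fin p → ℝ) (s : ℝ) :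
    ∑ j, (gaussianReal 0 1).real (Set.Ioi (t j + s)) *
      (P.map (fun ω i => X ω i - ρ i j * X ω j)).real (nzB ρ t j (t j + s)) ≤ 1 := by
  have hXm : ∀ j, Measurable (fun ω => X ω j) := fun j => (measurable_pi_apply j).comp hX
  have hYm : ∀ j, Measurable (fun ω i => X ω i - ρ i j * X ω j) := fun j =>
    measurable_pi_lambda _ fun i => (hXm i).sub ((hXm j).const_mul _)
  let R : Fin p → Set Ω := fun j => (fun ω => X ω j) ⁻¹' (Set.Ioi (t j + s)) ∩
    (fun ω i => X ω i - ρ i j * X ω j) ⁻¹' (nzB ρ t j (t j + s))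
  have hR : ∀ j, P.real (R j) = (gaussianReal 0 1).real (Set.Ioi (t j + s)) *
      (P.map (fun ω i => X ω i - ρ i j * X ω j)).real (nzB ρ t j (t j + s)) := by
    intro j
    rw [measureReal_def, (hind j).measure_inter_preimage_eq_mul _ _ measurableSet_Ioi
      (nzB_meas' _ _ _ _), ENNReal.toReal_mul, ← hlaw j,
      map_measureReal_apply (hXm j) measurableSet_Ioi,
      map_measureReal_apply (hYm j) (nzB_meas' _ _ _ _)]
    rfl
  have hlt : ∀ j k, j < k → Disjoint (R j) (R k) := by
    intro j k hjk
    rw [Set.disjoint_left]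
    rintro ω ⟨h1, h2⟩ ⟨h3, h4⟩
    have h5 : X ω k - ρ k j * X ω j + ρ k j * (t j + s) ≤ t k + (t j + s - t j) :=
      (h2 k hjk.ne').1
    have h6 : X ω j - ρ j k * X ω k + ρ j k * (t k + s) < t j + (t k + s - t k) :=
      (h4 j hjk.ne).2 hjk
    simp only [Set.mem_preimage, Set.mem_Ioi] at h1 h3
    rw [hsymm k j] at h5
    have h7 := abs_le.1 (hρ j k)
    have h8 : X ω k - t k - s ≤ ρ j k * (X ω j - t j - s) := by linarith
    have h9 : X ω j - t j - s < ρ j k * (X ω k - t k - s) := by linarith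
    have e1 : 0 < X ω j - t j - s := by linarith
    have e2 : 0 < X ω k - t k - s := by linarith
    nlinarith
  have hdisj : Pairwise (Function.onFun Disjoint R) := by
    intro j k hjk
    rcases lt_or_gt_of_ne hjk with h | h
    · exact hlt j k h
    · exact (hlt k j h).symm
  have hRm : ∀ j, MeasurableSet (R j) := fun j =>
    ((hXm j) measurableSet_Ioi).inter ((hYm j) (nzB_meas' _ _ _ _))
  simp_rw [← hR]
  rw [← measureReal_iUnion_fintype hdisj hRm]
  exact measureReal_le_one

lemma nz_unit {p : ℕ} (hp : 2 ≤ p) {Ω : Type*} [MeasurableSpace Ω]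
    (P : Measure Ω) [IsProbabilityMeasure P] (X : Ω → Fin p → ℝ) (hX : Measurable X)
    (ρ : Fin p → Fin p → ℝ) (hsymm : ∀ i j, ρ i j = ρ j i) (hρ : ∀ i j, |ρ i j| ≤ 1)
    (hlaw : ∀ j, P.map (fun ω => X ω j) = gaussianReal 0 1)
    (hind : ∀ j, IndepFun (fun ω => X ω j) (fun ω i => X ω i - ρ i j * X ω j) P)
    (t : Fin p → ℝ) (δ : ℝ) (hδ : 0 < δ) :
    P {ω | ∀ j, X ω j ≤ t j + δ} ≤ P {ω | ∀ j, X ω j ≤ t j} +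
      ENNReal.ofReal (δ * (√(2 * Real.log p) + 2)) := by
  have hXm : ∀ j, Measurable (fun ω => X ω j) := fun j => (measurable_pi_apply j).comp hX
  have hYm : ∀ j, Measurable (fun ω i => X ω i - ρ i j * X ω j) := fun j =>
    measurable_pi_lambda _ fun i => (hXm i).sub ((hXm j).const_mul _)
  let ν : Fin p → Measure (Fin p → ℝ) := fun j => P.map (fun ω i => X ω i - ρ i j * X ω j)
  have hν : ∀ j, IsProbabilityMeasure (ν j) := fun j =>
    Measure.isProbabilityMeasure_map (hYm j).aemeasurable
  let A : Fin p → Set (ℝ × (Fin p → ℝ)) := fun j =>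
    {z | z.1 ∈ Set.Ioc (t j) (t j + δ)} ∩ {z | z.2 ∈ nzB ρ t j z.1}
  have hA : ∀ j, MeasurableSet (A j) := fun j =>
    (measurable_fst measurableSet_Ioc).inter (nzB_meas ρ t j)
  let S : Fin p → Set Ω := fun j =>
    (fun ω => (X ω j, fun i => X ω i - ρ i j * X ω j)) ⁻¹' (A j)
  have hcover : {ω | ∀ j, X ω j ≤ t j + δ} ⊆ {ω | ∀ j, X ω j ≤ t j} ∪ ⋃ j, S j := by
    intro ω hω
    by_cases h : ∀ j, X ω j ≤ t j
    · exact Or.inl h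
    right
    have hne : (Finset.univ : Finset (Fin p)).Nonempty := ⟨⟨0, by omega⟩, Finset.mem_univ _⟩
    obtain ⟨m, _, hm⟩ := Finset.exists_max_image Finset.univ (fun j => X ω j - t j) hne
    let M : Finset (Fin p) := Finset.univ.filter fun j => X ω m - t m ≤ X ω j - t j
    have hM : M.Nonempty := ⟨m, by simp [M]⟩
    let j := M.min' hM
    have hj : X ω m - t m ≤ X ω j - t j := by
      have := M.min'_mem hM
      exact (Finset.mem_filter.1 this).2
    have hjmin : ∀ i, i < j → X ω i - t i < X ω m - t m := by
      intro i hi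
      by_contra hcon
      push Not at hcon
      exact absurd (M.min'_le i (Finset.mem_filter.2 ⟨Finset.mem_univ _, hcon⟩)) (not_le.2 hi)
    push Not at h
    obtain ⟨k, hk⟩ := h
    have hk2 := hm k (Finset.mem_univ _)
    refine Set.mem_iUnion.2 ⟨j, ⟨⟨?_, hω j⟩, fun i hi => ⟨?_, fun hij => ?_⟩⟩⟩
    · show t j < X ω j
      linarith
    · have := hm i (Finset.mem_univ _)
      show X ω i - ρ i j * X ω j + ρ i j * X ω j ≤ t i + (X ω j - t j)
      linarith
    · have := hjmin i hij
      show X ω i - ρ i j * X ω j + ρ i j * X ω j < t i + (X ω j - t j)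
      linarith
  let g : Fin p → ℝ → ENNReal := fun j x => gaussianPDF 0 1 x * ν j (Prod.mk x ⁻¹' A j)
  have hg : ∀ j, Measurable (g j) := fun j =>
    (measurable_gaussianPDF 0 1).mul (measurable_measure_prodMk_left (hA j))
  have hS : ∀ j, P (S j) = ∫⁻ s, g j (t j + s) := by
    intro j
    have h1 := (indepFun_iff_map_prod_eq_prod_map_map (hXm j).aemeasurable
      (hYm j).aemeasurable).1 (hind j)
    have h2 : P (S j) = (P.map (fun ω => (X ω j, fun i => X ω i - ρ i j * X ω j))) (A j) :=
      (Measure.map_apply ((hXm j).prodMk (hYm j)) (hA j)).symm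
    rw [h2, h1, hlaw j, Measure.prod_apply (hA j), gaussianReal_of_var_ne_zero 0 one_ne_zero,
      lintegral_withDensity_eq_lintegral_mul _ (measurable_gaussianPDF 0 1)
        (measurable_measure_prodMk_left (hA j)), lintegral_add_left_eq_self (g j) (t j)]
    rfl
  have hpt : ∀ s, ∑ j, g j (t j + s) ≤
      (Set.Ioc 0 δ).indicator (fun _ => ENNReal.ofReal (√(2 * Real.log p) + 2)) s := by
    intro s
    by_cases hs : s ∈ Set.Ioc 0 δ
    · rw [Set.indicator_of_mem hs]
      have h1 := nz_pointwise p hp (fun j => t j + s)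
        (fun j => (ν j).real (nzB ρ t j (t j + s))) (fun j => measureReal_nonneg)
        (fun j => measureReal_le_one) (nz_tail_sum P X hX ρ hsymm hρ hlaw hind t s)
      refine le_trans (le_of_eq ?_) (ENNReal.ofReal_le_ofReal h1)
      rw [ENNReal.ofReal_sum_of_nonneg
        (fun j _ => mul_nonneg (gaussianPDFReal_nonneg _ _ _) measureReal_nonneg)]
      refine Finset.sum_congr rfl fun j _ => ?_
      rw [ENNReal.ofReal_mul (gaussianPDFReal_nonneg _ _ _), ofReal_measureReal]
      have : Prod.mk (t j + s) ⁻¹' A j = nzB ρ t j (t j + s) := by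
        ext y
        simp only [A, Set.mem_preimage, Set.mem_inter_iff, Set.mem_ofPred_eq]
        refine and_iff_right ?_
        exact ⟨by linarith [hs.1], by linarith [hs.2]⟩
      simp only [g, this]
      rfl
    · rw [Set.indicator_of_notMem hs]
      refine le_of_eq (Finset.sum_eq_zero fun j _ => ?_)
      have : Prod.mk (t j + s) ⁻¹' A j = ∅ := by
        ext y
        simp only [A, Set.mem_preimage, Set.mem_inter_iff, Set.mem_ofPred_eq,
          Set.mem_empty_iff_false, iff_false, not_and]
        intro h
        exact absurd ⟨by linarith [h.1], by linarith [h.2]⟩ hs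
      simp [g, this]
  calc P {ω | ∀ j, X ω j ≤ t j + δ} ≤ P ({ω | ∀ j, X ω j ≤ t j} ∪ ⋃ j, S j) :=
        measure_mono hcover
    _ ≤ P {ω | ∀ j, X ω j ≤ t j} + ∑ j, P (S j) :=
        (measure_union_le _ _).trans (by gcongr; exact measure_iUnion_fintype_le _ _)
    _ ≤ _ := by
      gcongr
      simp_rw [hS]
      rw [← lintegral_finsetSum (f := fun j s => g j (t j + s)) _
        (fun j _ => (hg j).comp (measurable_const_add (t j)))]
      refine (lintegral_mono hpt).trans (le_of_eq ?_)
      rw [lintegral_indicator measurableSet_Ioc]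
      simp only [lintegral_const, Measure.restrict_apply_univ, Real.volume_Ioc, sub_zero]
      rw [mul_comm, ← ENNReal.ofReal_mul hδ.le]

theorem nazarov_gaussian_anticoncentration
    {p : ℕ} (hp : 2 ≤ p) {Ω : Type*} [MeasurableSpace Ω]
    (P : Measure Ω) [IsProbabilityMeasure P]
    (G : Ω → Fin p → ℝ) (hGmeas : Measurable G)
    (hGauss : ∀ t : Fin p → ℝ, ∃ v : NNReal,
      P.map (fun ω => ∑ j, t j * G ω j) = gaussianReal 0 v)
    (σ : ℝ) (hσ : 0 < σ)
    (hvar : ∀ j, σ ^ 2 ≤ ∫ ω, (G ω j) ^ 2 ∂P)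
    (t : Fin p → ℝ) (δ : ℝ) (hδ : 0 < δ) :
    (P {ω | ∀ j, G ω j ≤ t j + δ}).toReal - (P {ω | ∀ j, G ω j ≤ t j}).toReal
      ≤ (δ / σ) * (Real.sqrt (2 * Real.log p) + 2) := by
  -- standard deviations
  let c : Fin p → ℝ := fun j => √(∫ ω, (G ω j) ^ 2 ∂P)
  have hcσ : ∀ j, σ ≤ c j := fun j => Real.le_sqrt_of_sq_le (hvar j)
  have hc : ∀ j, 0 < c j := fun j => hσ.trans_le (hcσ j)
  have hc2 : ∀ j, c j ^ 2 = ∫ ω, (G ω j) ^ 2 ∂P := fun j =>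
    Real.sq_sqrt ((sq_nonneg σ).trans (hvar j))
  -- Gaussian law
  have hG : HasGaussianLaw G P := by
    refine ⟨isGaussian_of_map_eq_gaussianReal fun L => ?_⟩
    obtain ⟨v, hv⟩ := hGauss (fun j => L (Pi.single j 1))
    refine ⟨0, v, ?_⟩
    rw [Measure.map_map (by fun_prop) hGmeas, ← hv]
    congr 1
    ext ω
    simp only [Function.comp]
    conv_lhs => rw [← Finset.univ_sum_single (G ω), map_sum]
    refine Finset.sum_congr rfl fun j _ => ?_
    rw [show (Pi.single j (G ω j) : Fin p → ℝ) = G ω j • Pi.single j 1 by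
      rw [← Pi.single_smul]; simp, map_smul, smul_eq_mul, mul_comm]
  have hmean : ∀ j, ∫ ω, G ω j ∂P = 0 := by
    intro j
    obtain ⟨v, hv⟩ := hGauss (Pi.single j 1)
    have h1 : (fun ω => ∑ i, (Pi.single j 1 : Fin p → ℝ) i * G ω i) = fun ω => G ω j := by
      ext ω
      simp [Pi.single_apply]
    rw [h1] at hv
    have h2 := integral_map (μ := P) (φ := fun ω => G ω j) (f := fun x : ℝ => x)
      ((measurable_pi_apply j).comp hGmeas).aemeasurable (by fun_prop)
    rw [← h2, hv, integral_id_gaussianReal]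
  let X : Ω → Fin p → ℝ := fun ω j => (c j)⁻¹ * G ω j
  have hXmeas : Measurable X := by
    refine measurable_pi_lambda _ fun j => ?_
    exact ((measurable_pi_apply j).comp hGmeas).const_mul _
  let L : (Fin p → ℝ) →L[ℝ] (Fin p → ℝ) :=
    ContinuousLinearMap.pi fun j => (c j)⁻¹ • ContinuousLinearMap.proj j
  have hXG : HasGaussianLaw X P := hG.map L
  have hXj : ∀ j, HasGaussianLaw (fun ω => X ω j) P := fun j =>
    hXG.map (ContinuousLinearMap.proj (R := ℝ) (φ := fun _ : Fin p => ℝ) j)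
  have hXL : ∀ j, MemLp (fun ω => X ω j) 2 P := fun j => (hXj j).memLp_two
  have hXmean : ∀ j, ∫ ω, X ω j ∂P = 0 := by
    intro j
    simp only [X]
    rw [integral_const_mul, hmean, mul_zero]
  have hXvar : ∀ j, ∫ ω, X ω j * X ω j ∂P = 1 := by
    intro j
    have : ∀ ω, X ω j * X ω j = ((c j)⁻¹ ^ 2) * (G ω j) ^ 2 := fun ω => by simp only [X]; ring
    simp_rw [this]
    rw [integral_const_mul, ← hc2]
    have := hc j
    field_simp
  let ρ : Fin p → Fin p → ℝ := fun i j => ∫ ω, X ω i * X ω j ∂P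
  have hprod_int : ∀ i j, Integrable (fun ω => X ω i * X ω j) P := fun i j =>
    (hXL i).integrable_mul (hXL j)
  have hcov : ∀ i j, cov[fun ω => X ω i, fun ω => X ω j; P] = ρ i j := by
    intro i j
    rw [covariance_eq_sub (hXL i) (hXL j), hXmean, hXmean]
    simp [ρ]
  have hρ : ∀ i j, |ρ i j| ≤ 1 := by
    intro i j
    have key : ∀ a : ℝ, 0 ≤ 1 + 2 * a * ρ i j + a ^ 2 := by
      intro a
      have h0 : 0 ≤ ∫ ω, (X ω i + a * X ω j) ^ 2 ∂P := integral_nonneg fun ω => sq_nonneg _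
      have h1 : ∀ ω, (X ω i + a * X ω j) ^ 2 =
          X ω i * X ω i + (2 * a) * (X ω i * X ω j) + a ^ 2 * (X ω j * X ω j) := fun ω => by ring
      simp_rw [h1] at h0
      rw [integral_add (f := fun ω => X ω i * X ω i + (2 * a) * (X ω i * X ω j))
        ((hprod_int i i).add ((hprod_int i j).const_mul _)) ((hprod_int j j).const_mul _),
        integral_add (hprod_int i i) ((hprod_int i j).const_mul _), integral_const_mul, integral_const_mul,
        hXvar, hXvar, mul_one] at h0
      exact h0
    have k1 := key 1
    have k2 := key (-1)
    rw [abs_le]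
    constructor <;> linarith
  have hlaw : ∀ j, P.map (fun ω => X ω j) = gaussianReal 0 1 := by
    intro j
    rw [(hXj j).map_eq_gaussianReal, hXmean, ← covariance_self (hXj j).aemeasurable, hcov]
    simp [ρ, hXvar]
  have hind : ∀ j, IndepFun (fun ω => X ω j) (fun ω i => X ω i - ρ i j * X ω j) P := by
    intro j
    let Lj : (Fin p → ℝ) →L[ℝ] (Unit → ℝ) × (Fin p → ℝ) :=
      (ContinuousLinearMap.pi fun _ => ContinuousLinearMap.proj j).prod
        (ContinuousLinearMap.pi fun i =>
          ContinuousLinearMap.proj i - ρ i j • ContinuousLinearMap.proj j)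
    have h1 : HasGaussianLaw (fun ω => ((fun _ : Unit => X ω j),
        (fun i => X ω i - ρ i j * X ω j))) P := hXG.map Lj
    have h2 := HasGaussianLaw.indepFun_of_covariance_eval
      (X := fun (_ : Unit) ω => X ω j) (Y := fun i ω => X ω i - ρ i j * X ω j) h1 ?_
    · exact h2.comp (φ := fun f : Unit → ℝ => f ()) (ψ := id) (measurable_pi_apply _) measurable_id
    · intro _ i
      rw [covariance_fun_sub_right (hXL j) (hXL i) ((hXL j).const_mul _),
        covariance_const_mul_right (X := fun ω => X ω j) (Y := fun ω => X ω j) (ρ i j),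
        hcov, hcov]
      simp only [ρ, hXvar]
      simp_rw [mul_comm (X _ j)]
      ring
  have main := nz_unit hp P X hXmeas ρ (fun i j => by simp only [ρ, mul_comm]) hρ hlaw hind
    (fun j => (c j)⁻¹ * t j) (δ / σ) (by positivity)
  have e1 : {ω | ∀ j, X ω j ≤ (c j)⁻¹ * t j} = {ω | ∀ j, G ω j ≤ t j} := by
    ext ω
    refine forall_congr' fun j => ?_
    exact mul_le_mul_iff_right₀ (inv_pos.2 (hc j))
  have e2 : {ω | ∀ j, G ω j ≤ t j + δ} ⊆ {ω | ∀ j, X ω j ≤ (c j)⁻¹ * t j + δ / σ} := by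
    intro ω hω j
    have h1 : X ω j ≤ (c j)⁻¹ * (t j + δ) :=
      mul_le_mul_of_nonneg_left (hω j) (inv_pos.2 (hc j)).le
    have h2 : (c j)⁻¹ * δ ≤ δ / σ := by
      rw [div_eq_inv_mul]
      exact mul_le_mul_of_nonneg_right (inv_anti₀ hσ (hcσ j)) hδ.le
    linarith
  rw [e1] at main
  have m2 := (measure_mono e2).trans main
  have m3 := ENNReal.toReal_mono (by finiteness) m2
  rw [ENNReal.toReal_add (by finiteness) (by finiteness), ENNReal.toReal_ofReal (by positivity)] at m3
  linarith
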